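/- On the set where Σ_{i=1}^{n−1} x_i^2 > 0 and x_n > 0, the function u(x) = (c_{n,q} x_n^q / Σ_{i=1}^{n−1} x_i^2)^{1/(q−2)} with n > 3 and q > 2(n−1)/(n−3) is a classical (smooth) solution of the Euler–Lagrange equation Σ_{i=1}^{n−1} D_i(D_i u) + D_n(|D_n u|^{q−2} D_n u) = 0 of the functional w ↦ ∫ (½ Σ_{i=1}^{n−1} |D_i w|^2 + (1/q)|D_n w|^q) dx. -/

import Mathlib

open Finset

theorem hasFDerivAt_euclidean_apply {ι : Type*} (i : ι) (x : EuclideanSpace ℝ ι) :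
    HasFDerivAt (fun y : EuclideanSpace ℝ ι => y i) (EuclideanSpace.proj (𝕜 := ℝ) i) x :=
  (EuclideanSpace.proj i : EuclideanSpace ℝ ι →L[ℝ] ℝ).hasFDerivAt

/-- The sum of the squares of all coordinates but the one with index `l`. -/
noncomputable def sumSqErase {ι : Type*} [Fintype ι] [DecidableEq ι] (l : ι)
    (x : EuclideanSpace ℝ ι) : ℝ :=
  ∑ i ∈ univ.erase l, (x i) ^ 2

section SumSqErase

variable {ι : Type*} [Fintype ι] [DecidableEq ι] {l i : ι} {x : EuclideanSpace ℝ ι}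

theorem hasFDerivAt_sumSqErase (l : ι) (x : EuclideanSpace ℝ ι) :
    HasFDerivAt (sumSqErase l)
      (∑ i ∈ univ.erase l, (2 * x i) • (EuclideanSpace.proj i : EuclideanSpace ℝ ι →L[ℝ] ℝ)) x := by
  unfold sumSqErase
  refine HasFDerivAt.fun_sum fun i _ => ?_
  simpa using (hasFDerivAt_euclidean_apply i x).pow 2

theorem contDiff_sumSqErase (l : ι) {k : WithTop ℕ∞} :
    ContDiff ℝ k (sumSqErase l : EuclideanSpace ℝ ι → ℝ) := by
  unfold sumSqErase
  exact ContDiff.sum fun i _ => ((EuclideanSpace.proj (𝕜 := ℝ) i).contDiff).pow 2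

theorem isOpen_pos_and_sumSqErase_pos (l : ι) :
    IsOpen {x : EuclideanSpace ℝ ι | 0 < x l ∧ 0 < sumSqErase l x} :=
  (isOpen_lt continuous_const (EuclideanSpace.proj (𝕜 := ℝ) l).continuous).inter
    (isOpen_lt continuous_const (contDiff_sumSqErase l (k := 0)).continuous)

theorem hasFDerivAt_rpow_mul_sumSqErase_rpow (K p s : ℝ) (hx : 0 < x l)
    (hS : 0 < sumSqErase l x) :
    HasFDerivAt (fun y : EuclideanSpace ℝ ι => K * (y l) ^ p * (sumSqErase l y) ^ s)
      ((K * x l ^ p) • ((s * sumSqErase l x ^ (s - 1)) •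
          ∑ i ∈ univ.erase l, (2 * x i) • (EuclideanSpace.proj i : EuclideanSpace ℝ ι →L[ℝ] ℝ)) +
        sumSqErase l x ^ s • (K • ((p * x l ^ (p - 1)) •
          (EuclideanSpace.proj l : EuclideanSpace ℝ ι →L[ℝ] ℝ)))) x :=
  (((hasFDerivAt_euclidean_apply l x).rpow_const (Or.inl hx.ne')).const_mul K).mul
    ((hasFDerivAt_sumSqErase l x).rpow_const (Or.inl hS.ne'))

theorem fderiv_rpow_mul_sumSqErase_rpow_single_self (K p s : ℝ) (hx : 0 < x l)
    (hS : 0 < sumSqErase l x) :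
    fderiv ℝ (fun y : EuclideanSpace ℝ ι => K * (y l) ^ p * (sumSqErase l y) ^ s) x
      (EuclideanSpace.single l 1) = K * p * x l ^ (p - 1) * sumSqErase l x ^ s := by
  rw [(hasFDerivAt_rpow_mul_sumSqErase_rpow K p s hx hS).fderiv]
  simp
  ring

theorem fderiv_rpow_mul_sumSqErase_rpow_single_of_ne (K p s : ℝ) (hx : 0 < x l)
    (hS : 0 < sumSqErase l x) (hi : i ≠ l) :
    fderiv ℝ (fun y : EuclideanSpace ℝ ι => K * (y l) ^ p * (sumSqErase l y) ^ s) x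
      (EuclideanSpace.single i 1) =
        (2 * s * K) * x l ^ p * sumSqErase l x ^ (s - 1) * x i := by
  rw [(hasFDerivAt_rpow_mul_sumSqErase_rpow K p s hx hS).fderiv]
  simp [hi.symm]
  ring

theorem fderiv_fderiv_rpow_mul_sumSqErase_rpow_single_of_ne (K p s : ℝ) (hx : 0 < x l)
    (hS : 0 < sumSqErase l x) (hi : i ≠ l) :
    fderiv ℝ (fun y => fderiv ℝ
        (fun y : EuclideanSpace ℝ ι => K * (y l) ^ p * (sumSqErase l y) ^ s) y
        (EuclideanSpace.single i 1)) x (EuclideanSpace.single i 1) =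
      2 * s * K * x l ^ p *
        (2 * (s - 1) * sumSqErase l x ^ (s - 2) * x i ^ 2 + sumSqErase l x ^ (s - 1)) := by
  have hev : (fun y => fderiv ℝ
        (fun y : EuclideanSpace ℝ ι => K * (y l) ^ p * (sumSqErase l y) ^ s) y
        (EuclideanSpace.single i 1)) =ᶠ[nhds x]
      fun y => (2 * s * K) * y l ^ p * sumSqErase l y ^ (s - 1) * y i := by
    filter_upwards [(isOpen_pos_and_sumSqErase_pos l).mem_nhds ⟨hx, hS⟩] with y hy
    exact fderiv_rpow_mul_sumSqErase_rpow_single_of_ne K p s hy.1 hy.2 hi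
  have hd := hasFDerivAt_rpow_mul_sumSqErase_rpow (2 * s * K) p (s - 1) hx hS
  rw [hev.fderiv_eq, (hd.fun_mul (hasFDerivAt_euclidean_apply i x)).fderiv]
  have h1 := fderiv_rpow_mul_sumSqErase_rpow_single_of_ne (2 * s * K) p (s - 1) hx hS hi
  rw [hd.fderiv] at h1
  rw [add_apply, smul_apply,
    smul_apply, h1, show s - 1 - 1 = s - 2 by ring]
  simp
  ring

/-- The Laplacian in all variables but the one with index `l`. -/
theorem sum_fderiv_fderiv_rpow_mul_sumSqErase_rpow (K p s : ℝ) (hx : 0 < x l)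
    (hS : 0 < sumSqErase l x) :
    ∑ i ∈ univ.erase l, fderiv ℝ (fun y => fderiv ℝ
        (fun y : EuclideanSpace ℝ ι => K * (y l) ^ p * (sumSqErase l y) ^ s) y
        (EuclideanSpace.single i 1)) x (EuclideanSpace.single i 1) =
      2 * s * K * (2 * (s - 1) + ((Fintype.card ι : ℝ) - 1)) *
        x l ^ p * sumSqErase l x ^ (s - 1) := by
  rw [sum_congr rfl fun i hi => fderiv_fderiv_rpow_mul_sumSqErase_rpow_single_of_ne K p s hx hS
    (ne_of_mem_erase hi), ← mul_sum, sum_add_distrib, ← mul_sum]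
  have hcard : (((univ.erase l).card : ℕ) : ℝ) = (Fintype.card ι : ℝ) - 1 := by
    rw [card_erase_of_mem (mem_univ l), card_univ,
      Nat.cast_sub (Fintype.card_pos_iff.mpr ⟨l⟩), Nat.cast_one]
  have hpow : sumSqErase l x ^ (s - 1) = sumSqErase l x ^ (s - 2) * sumSqErase l x := by
    rw [← Real.rpow_add_one hS.ne']
    congr 1
    ring
  rw [sum_const, nsmul_eq_mul, hcard, ← sumSqErase, hpow]
  ring

/-- The `q`-Laplacian in the variable with index `l`. -/
theorem fderiv_abs_rpow_mul_fderiv_rpow_mul_sumSqErase_rpow {K p : ℝ} (s q : ℝ) (hK : 0 < K)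
    (hp : 0 < p) (hx : 0 < x l) (hS : 0 < sumSqErase l x) :
    let v := fun y : EuclideanSpace ℝ ι => K * (y l) ^ p * (sumSqErase l y) ^ s
    fderiv ℝ (fun y => |fderiv ℝ v y (EuclideanSpace.single l 1)| ^ (q - 2) *
        fderiv ℝ v y (EuclideanSpace.single l 1)) x (EuclideanSpace.single l 1) =
      (K * p) ^ (q - 1) * ((p - 1) * (q - 1)) * x l ^ ((p - 1) * (q - 1) - 1) *
        sumSqErase l x ^ (s * (q - 1)) := by
  intro v
  rw [← fderiv_rpow_mul_sumSqErase_rpow_single_self _ _ _ hx hS]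
  congr 1
  apply Filter.EventuallyEq.fderiv_eq
  filter_upwards [(isOpen_pos_and_sumSqErase_pos l).mem_nhds ⟨hx, hS⟩] with y hy
  obtain ⟨hy, hSy⟩ := hy
  rw [fderiv_rpow_mul_sumSqErase_rpow_single_self K p s hy hSy]
  have hA : 0 < y l ^ (p - 1) := Real.rpow_pos_of_pos hy _
  have hB : 0 < sumSqErase l y ^ s := Real.rpow_pos_of_pos hSy _
  have hKp : 0 < K * p := mul_pos hK hp
  rw [abs_of_pos (by positivity), ← Real.rpow_add_one (by positivity),
    show q - 2 + 1 = q - 1 by ring, Real.mul_rpow (by positivity) hB.le,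
    Real.mul_rpow hKp.le hA.le, ← Real.rpow_mul hy.le, ← Real.rpow_mul hSy.le]

end SumSqErase

/-- The constant in Marcellini's solution is positive. -/
theorem marcellini_const_pos {m q : ℝ} (hm : 2 < m) (hq : 2 * m / (m - 2) < q) :
    2 < q ∧ 0 < (m / (q - 1) - 2 / (q - 2)) * ((q - 2) / q) ^ (q - 1) := by
  have hm' : 0 < m - 2 := by linarith
  rw [div_lt_iff₀ hm'] at hq
  have hq2 : 2 < q := by nlinarith
  have h2 : 0 < q - 2 := by linarith
  refine ⟨hq2, mul_pos ?_ (Real.rpow_pos_of_pos (by positivity) _)⟩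
  rw [sub_pos, div_lt_div_iff₀ h2 (by linarith)]
  linarith

/-- On the open set where `Σ_{i<n} x_i² > 0` and `xₙ > 0`, with `n > 3` and
`q > 2(n−1)/(n−3)`, the function `u(x) = (c_{n,q} xₙ^q / Σ_{i<n} x_i²)^{1/(q−2)}`
is a classical (smooth) solution of the Euler–Lagrange equation
`Σ_{i<n} D_i(D_i u) + D_n(|D_n u|^{q−2} D_n u) = 0` of Marcellini's functional. -/
theorem marcellini_minimizer_solves_EL (n : ℕ) (hn : 3 < n) (q : ℝ)
    (hq : 2 * ((n : ℝ) - 1) / ((n : ℝ) - 3) < q) :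
    let ln : Fin n := ⟨n - 1, by omega⟩
    let e : Fin n → EuclideanSpace ℝ (Fin n) := fun i => EuclideanSpace.single i 1
    let S : EuclideanSpace ℝ (Fin n) → ℝ := fun x => ∑ i ∈ Finset.univ.erase ln, (x i) ^ 2
    let c : ℝ := (((n : ℝ) - 1) / (q - 1) - 2 / (q - 2)) * ((q - 2) / q) ^ (q - 1)
    let u : EuclideanSpace ℝ (Fin n) → ℝ := fun x => (c * (x ln) ^ q / S x) ^ (1 / (q - 2))
    let U : Set (EuclideanSpace ℝ (Fin n)) := {x | 0 < x ln ∧ 0 < S x}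
    ContDiffOn ℝ (⊤ : ℕ∞) u U ∧
      ∀ x ∈ U,
        (∑ i ∈ Finset.univ.erase ln, fderiv ℝ (fun y => fderiv ℝ u y (e i)) x (e i)) +
          fderiv ℝ (fun y => |fderiv ℝ u y (e ln)| ^ (q - 2) * fderiv ℝ u y (e ln)) x (e ln)
          = 0 := by
  intro ln e S c u U
  have hn' : (3 : ℝ) < n := by exact_mod_cast hn
  obtain ⟨hq2, hc⟩ : 2 < q ∧ 0 < c :=
    marcellini_const_pos (m := (n : ℝ) - 1) (by linarith)
      (by rwa [show (n : ℝ) - 1 - 2 = n - 3 by ring])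
  have hd : 0 < q - 2 := by linarith
  have hU : IsOpen U := isOpen_pos_and_sumSqErase_pos ln
  set K : ℝ := c ^ (1 / (q - 2)) with hKdef
  have hK : 0 < K := Real.rpow_pos_of_pos hc _
  let v : EuclideanSpace ℝ (Fin n) → ℝ := fun y =>
    K * (y ln) ^ (q / (q - 2)) * (sumSqErase ln y) ^ (-(1 / (q - 2)))
  have huv : Set.EqOn u v U := by
    rintro y ⟨hy, hSy⟩
    change (c * y ln ^ q / S y) ^ (1 / (q - 2)) = K * _ * (S y) ^ _
    rw [Real.div_rpow (by positivity) hSy.le, Real.mul_rpow hc.le (by positivity),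
      ← Real.rpow_mul hy.le, mul_one_div, Real.rpow_neg hSy.le, div_eq_mul_inv]
  refine ⟨?_, fun x hxU => ?_⟩
  · refine ContDiffOn.congr (fun y hy => ContDiffAt.contDiffWithinAt ?_) huv
    have h1 : ContDiffAt ℝ (⊤ : ℕ∞) (fun y : EuclideanSpace ℝ (Fin n) => y ln) y :=
      (EuclideanSpace.proj (𝕜 := ℝ) ln).contDiff.contDiffAt
    exact (contDiffAt_const.mul (h1.rpow_const_of_ne hy.1.ne')).mul
      ((contDiff_sumSqErase ln).contDiffAt.rpow_const_of_ne hy.2.ne')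
  have hfd : ∀ y ∈ U, fderiv ℝ u y = fderiv ℝ v y := fun y hy =>
    (huv.eventuallyEq_of_mem (hU.mem_nhds hy)).fderiv_eq
  have hlap : ∀ i ∈ univ.erase ln, fderiv ℝ (fun y => fderiv ℝ u y (e i)) x (e i) =
      fderiv ℝ (fun y => fderiv ℝ v y (e i)) x (e i) := fun i _ => by
    congr 1
    apply Filter.EventuallyEq.fderiv_eq
    filter_upwards [hU.mem_nhds hxU] with y hy
    rw [hfd y hy]
  have hqlap : fderiv ℝ (fun y => |fderiv ℝ u y (e ln)| ^ (q - 2) * fderiv ℝ u y (e ln)) x =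
      fderiv ℝ (fun y => |fderiv ℝ v y (e ln)| ^ (q - 2) * fderiv ℝ v y (e ln)) x := by
    apply Filter.EventuallyEq.fderiv_eq
    filter_upwards [hU.mem_nhds hxU] with y hy
    rw [hfd y hy]
  have hp : 0 < q / (q - 2) := by positivity
  rw [sum_congr rfl hlap, hqlap,
    sum_fderiv_fderiv_rpow_mul_sumSqErase_rpow K _ _ hxU.1 hxU.2,
    fderiv_abs_rpow_mul_fderiv_rpow_mul_sumSqErase_rpow _ q hK hp hxU.1 hxU.2, Fintype.card_fin]
  have hKpow : K ^ (q - 1) = K * c := by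
    rw [show q - 1 = q - 2 + 1 by ring, Real.rpow_add_one hK.ne', hKdef, ← Real.rpow_mul hc.le,
      one_div_mul_cancel hd.ne', Real.rpow_one, mul_comm]
  have hcp : c * (q / (q - 2)) ^ (q - 1) = ((n : ℝ) - 1) / (q - 1) - 2 / (q - 2) := by
    rw [mul_assoc, ← Real.mul_rpow (by positivity) hp.le,
      show (q - 2) / q * (q / (q - 2)) = 1 by field_simp, Real.one_rpow, mul_one]
  rw [show (q / (q - 2) - 1) * (q - 1) - 1 = q / (q - 2) by field_simp; ring,
    show -(1 / (q - 2)) * (q - 1) = -(1 / (q - 2)) - 1 by field_simp; ring,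
    Real.mul_rpow hK.le hp.le, hKpow, mul_assoc K c, hcp, ← add_mul, ← add_mul]
  have hq1 : q - 1 ≠ 0 := by linarith
  have hcoef : 2 * -(1 / (q - 2)) * K * (2 * (-(1 / (q - 2)) - 1) + ((n : ℝ) - 1)) +
      K * (((n : ℝ) - 1) / (q - 1) - 2 / (q - 2)) * ((q / (q - 2) - 1) * (q - 1)) = 0 := by
    field_simp
    ring
  rw [hcoef, zero_mul, zero_mul]
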